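/- In a right-angled Coxeter group W, suppose x₁, x₂, y₁, y₂ form a butterfly: x₁ ≠ x₂, y₁ ≠ y₂, and each of y₁, y₂ covers each of x₁, x₂ in Bruhat order. Then there exist u, v ∈ W, non-commuting simple reflections s, s', and m ≥ 1, such that we have length-additive factorizations x₁ = u·A^(m)(s,s')·v, x₂ = u·A^(m)(s',s)·v, and {y₁, y₂} = {u·A^(m+1)(s,s')·v, u·A^(m+1)(s',s)·v}, where A^(m)(s,s') = ss'ss'⋯ is the alternating word with m letters. -/

import Mathlib

open CoxeterSystem

variable {B W : Type*} [Group W] {M : CoxeterMatrix B}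

/-- One step of Bruhat order: multiply on the right by a reflection, increasing length. -/
def bruhatStep (cs : CoxeterSystem M W) (x y : W) : Prop :=
  ∃ t : W, cs.IsReflection t ∧ y = x * t ∧ cs.length x < cs.length y

/-- Bruhat order on a Coxeter group. -/
def bruhatLE (cs : CoxeterSystem M W) : W → W → Prop :=
  Relation.ReflTransGen (bruhatStep cs)

/-- Strict Bruhat order. -/
def bruhatLT (cs : CoxeterSystem M W) (x y : W) : Prop :=
  bruhatLE cs x y ∧ x ≠ y

/-- Cover relation in Bruhat order. -/
def bruhatCovBy (cs : CoxeterSystem M W) (x y : W) : Prop :=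
  bruhatLE cs x y ∧ cs.length y = cs.length x + 1

/-- The Bruhat interval `[u, v]`. -/
def bruhatInterval (cs : CoxeterSystem M W) (u v : W) : Set W :=
  {x | bruhatLE cs u x ∧ bruhatLE cs x v}

/-- The support of `w`: simple reflections appearing in a reduced word for `w`. -/
def supp (cs : CoxeterSystem M W) (w : W) : Set B :=
  {i | ∃ ω : List B, cs.IsReduced ω ∧ w = cs.wordProd ω ∧ i ∈ ω}

/-- The alternating word `i, i', i, i', …` with `m` letters, starting with `i`. -/
def altList (i i' : B) : ℕ → List B
  | 0 => []
  | (m + 1) => i :: altList i' i m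

/-- A Bruhat cover, witnessed by a single reflection. -/
def ReflCov (cs : CoxeterSystem M W) (x y : W) : Prop :=
  ∃ t : W, cs.IsReflection t ∧ y = x * t ∧ cs.length y = cs.length x + 1

theorem bruhatLE_length_le {cs : CoxeterSystem M W} {x y : W} (h : bruhatLE cs x y) :
    cs.length x ≤ cs.length y := by
  induction h with
  | refl => exact le_rfl
  | tail _ hbc ih =>
    obtain ⟨_, _, _, hlt⟩ := hbc
    omega

theorem bruhatCovBy.reflCov {cs : CoxeterSystem M W} {x y : W} (h : bruhatCovBy cs x y) :
    ReflCov cs x y := by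
  obtain ⟨hle, hlen⟩ := h
  rcases Relation.ReflTransGen.cases_head hle with rfl | ⟨c, ⟨t, ht, rfl, hlt⟩, hc⟩
  · omega
  · rcases Relation.ReflTransGen.cases_head hc with rfl | ⟨d, ⟨t', ht', rfl, hlt'⟩, hd⟩
    · exact ⟨t, ht, rfl, hlen⟩
    · have := bruhatLE_length_le hd
      omega

section RightAngled

variable (cs : CoxeterSystem M W) (hra : ∀ i j : B, i ≠ j → M i j = 2 ∨ M i j = 0)

include hra

theorem isLiftable_of_rightAngled {G : Type*} [Monoid G] {f : B → G}
    (hsq : ∀ i, f i * f i = 1)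
    (hcomm : ∀ i j, i ≠ j → M i j = 2 → f i * f j * (f i * f j) = 1) :
    M.IsLiftable f := by
  intro i j
  by_cases hij : i = j
  · subst hij
    rw [M.diagonal, pow_one, hsq]
  · rcases hra i j hij with h | h
    · rw [h, pow_two, hcomm i j hij h]
    · rw [h, pow_zero]

/-- The parity of the number of occurrences of `j` in a word is a homomorphism. -/
theorem exists_parity (j : B) : ∃ χ : W →* Multiplicative (ZMod 2),
    χ (cs.simple j) = Multiplicative.ofAdd 1 ∧ ∀ i, i ≠ j → χ (cs.simple i) = 1 := by
  classical
  have hsq : ∀ z : Multiplicative (ZMod 2), z * z = 1 := by decide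
  refine ⟨cs.lift ⟨fun i => if i = j then Multiplicative.ofAdd 1 else 1,
    isLiftable_of_rightAngled hra (fun _ => hsq _) (fun _ _ _ _ => hsq _)⟩, ?_, ?_⟩
  · rw [cs.lift_apply_simple]; simp
  · intro i hi
    rw [cs.lift_apply_simple]; simp [hi]

theorem eq_of_mul_simple_eq {x u w : W} {a j : B} (hx : x = u * cs.simple a * w)
    (hxj : x * cs.simple j = u * w) : j = a := by
  obtain ⟨χ, h1, h2⟩ := exists_parity cs hra a
  by_contra hja
  have h := congrArg χ hxj
  rw [hx] at h
  simp only [map_mul, h1, h2 j hja, mul_one] at h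
  rw [mul_right_comm, mul_eq_left] at h
  exact absurd h (by decide)

theorem simple_injective_of_rightAngled {i j : B} (h : cs.simple i = cs.simple j) : i = j :=
  eq_of_mul_simple_eq cs hra (x := cs.simple j) (u := 1) (w := 1) (a := j) (by simp)
    (by rw [h]; simp)

theorem simple_mul_simple_pow_eq_one {p q : B} (hpq : M p q = 0) {k : ℕ}
    (hk : (cs.simple p * cs.simple q) ^ k = 1) : k = 0 := by
  classical
  have hne : p ≠ q := by
    rintro rfl
    rw [M.diagonal] at hpq
    omega
  have hqp : M q p = 0 := by rw [M.symmetric]; exact hpq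
  let f : B → DihedralGroup 0 := fun i =>
    if i = p then DihedralGroup.sr 0 else if i = q then DihedralGroup.sr 1 else 1
  have hsq : ∀ i, f i * f i = 1 := by
    intro i
    dsimp only [f]
    split_ifs <;> simp
  have hlift : M.IsLiftable f := by
    refine isLiftable_of_rightAngled hra hsq ?_
    intro i j hij hM
    have h1 : f i = 1 ∨ f j = 1 := by
      by_cases hip : i = p
      · right
        have hjp : j ≠ p := fun h => hij (hip.trans h.symm)
        have hjq : j ≠ q := by rintro rfl; subst hip; omega
        simp [f, hjp, hjq]
      · by_cases hiq : i = q
        · right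
          have hjq : j ≠ q := fun h => hij (hiq.trans h.symm)
          have hjp : j ≠ p := by rintro rfl; subst hiq; omega
          simp [f, hjp, hjq]
        · left
          simp [f, hip, hiq]
    rcases h1 with h1 | h1 <;> simp [h1, hsq]
  have h := congrArg (cs.lift ⟨f, hlift⟩) hk
  rw [map_pow, map_mul, cs.lift_apply_simple, cs.lift_apply_simple, map_one] at h
  have hp : f p = DihedralGroup.sr 0 := by simp [f]
  have hq : f q = DihedralGroup.sr 1 := by simp [f, hne.symm]
  rw [hp, hq, DihedralGroup.sr_mul_sr, sub_zero, DihedralGroup.r_one_pow,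
    DihedralGroup.one_def] at h
  have h' : ((k : ℕ) : ZMod 0) = 0 := DihedralGroup.r.inj h
  exact Int.natCast_eq_zero.mp h'

omit hra in
theorem commute_of_eq_two {i j : B} (h : M i j = 2) :
    cs.simple i * cs.simple j = cs.simple j * cs.simple i := by
  have h2 := cs.simple_mul_simple_pow i j
  rw [h, pow_two, mul_eq_one_iff_eq_inv] at h2
  rw [h2, mul_inv_rev, cs.inv_simple, cs.inv_simple]

open Classical in
/-- The group acts on `W × ZMod 2`: by conjugation on the first factor, recording in the second
how often a simple reflection is met. -/
theorem exists_reflectionAction : ∃ F : W →* Function.End (W × ZMod 2),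
    ∀ i p, F (cs.simple i) p = (cs.simple i * p.1 * cs.simple i,
      p.2 + if p.1 = cs.simple i then 1 else 0) := by
  refine ⟨cs.lift ⟨fun i => fun p => (cs.simple i * p.1 * cs.simple i,
      p.2 + if p.1 = cs.simple i then 1 else 0), isLiftable_of_rightAngled hra ?_ ?_⟩, ?_⟩
  · intro i
    funext p
    obtain ⟨x, ε⟩ := p
    have h2 : (1 + 1 : ZMod 2) = 0 := by decide
    have hiff : cs.simple i * x * cs.simple i = cs.simple i ↔ x = cs.simple i := by
      rw [mul_eq_right, mul_eq_one_iff_inv_eq, cs.inv_simple, eq_comm]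
    refine Prod.ext ?_ ?_
    · change cs.simple i * (cs.simple i * x * cs.simple i) * cs.simple i = x
      simp [mul_assoc]
    · change (ε + if x = cs.simple i then 1 else 0) +
        (if cs.simple i * x * cs.simple i = cs.simple i then 1 else 0) = ε
      simp only [hiff, add_assoc]
      split_ifs <;> simp [h2]
  · intro i j _ hM
    funext p
    obtain ⟨x, ε⟩ := p
    have hc := commute_of_eq_two cs hM
    set s := cs.simple i
    set t := cs.simple j
    have hss : s * s = 1 := cs.simple_mul_simple_self i
    have htt : t * t = 1 := cs.simple_mul_simple_self j
    have key : ∀ a b z : W, a * b = b * a → a * a = 1 → (a * z * a = b ↔ z = b) := by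
      intro a b z hab haa
      constructor
      · intro h
        have : a * (a * z * a) * a = a * b * a := by rw [h]
        rw [hab] at this
        simpa [mul_assoc, haa, ← mul_assoc a a] using this
      · rintro rfl
        rw [hab, mul_assoc, haa, mul_one]
    refine Prod.ext ?_ ?_
    · change s * (t * (s * (t * x * t) * s) * t) * s = x
      have h1 : s * (t * (s * (t * x * t) * s) * t) * s
          = (s * t) * (s * t) * x * ((t * s) * (t * s)) := by simp only [mul_assoc]
      have h2 : (s * t) * (s * t) = 1 := by
        nth_rewrite 2 [hc]
        rw [mul_assoc, ← mul_assoc t t, htt, one_mul, hss]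
      rw [h1, ← hc, h2, one_mul, mul_one]
    · change (((ε + if x = t then 1 else 0) + (if t * x * t = s then 1 else 0)) +
        (if s * (t * x * t) * s = t then 1 else 0)) +
        (if t * (s * (t * x * t) * s) * t = s then 1 else 0) = ε
      simp only [key t s _ hc.symm htt, key s t _ hc hss, key t t _ rfl htt,
        key s s _ rfl hss]
      have h2 : ∀ e a b : ZMod 2, e + a + b + a + b = e := by decide
      exact h2 _ _ _
  · intro i p
    exact congrFun (cs.lift_apply_simple (G := Function.End (W × ZMod 2)) _ i) p

/-- The parity cocycle of right inversions. -/
theorem exists_inversionCocycle : ∃ η : W → W → ZMod 2,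
    (∀ v w x, η (v * w) x = η w x + η v (w * x * w⁻¹)) ∧
    (∀ i, η (cs.simple i) (cs.simple i) = 1) ∧
    (∀ i x, x ≠ cs.simple i → η (cs.simple i) x = 0) := by
  classical
  obtain ⟨F, hF⟩ := exists_reflectionAction cs hra
  have hform : ∀ w x ε, F w (x, ε) = (w * x * w⁻¹, ε + (F w (x, 0)).2) := by
    intro w
    induction w using cs.simple_induction_left with
    | one =>
      intro x ε
      rw [map_one]
      change (x, ε) = (1 * x * 1⁻¹, ε + 0)
      simp
    | mul_simple_left w i ih =>
      intro x ε
      have h : ∀ p, F (cs.simple i * w) p = F (cs.simple i) (F w p) := by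
        intro p
        rw [map_mul]
        rfl
      rw [h, h, ih x ε, ih x 0, hF, hF]
      simp [mul_assoc, add_assoc]
  refine ⟨fun w x => (F w (x, 0)).2, ?_, ?_, ?_⟩
  · intro v w x
    have h : F (v * w) (x, 0) = F v (F w (x, 0)) := by
      rw [map_mul]
      rfl
    change (F (v * w) (x, 0)).2 = _
    rw [h, hform w x 0, hform v]
    simp
  · intro i
    simp [hF]
  · intro i x hx
    simp [hF, hx]

/-- Conjugating a right inversion by a different simple reflection. -/
theorem length_mul_mul_simple_lt {w t : W} {i : B} (ht : cs.IsReflection t)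
    (hlt : cs.length (w * t) < cs.length w) (hne : t ≠ cs.simple i) :
    cs.length (w * t * cs.simple i) < cs.length (w * cs.simple i) := by
  obtain ⟨η, hmul, hself, hother⟩ := exists_inversionCocycle cs hra
  have hone : ∀ x, η 1 x = 0 := by
    intro x
    have := hmul 1 1 x
    simpa using this
  have hmem : ∀ (ω : List B) x, η (cs.wordProd ω) x ≠ 0 → x ∈ cs.rightInvSeq ω := by
    intro ω
    induction ω with
    | nil => intro x hx; simp [hone] at hx
    | cons j ω ih =>
      intro x hx
      rw [cs.wordProd_cons, hmul] at hx
      rw [rightInvSeq, List.mem_cons]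
      by_cases hxj : cs.wordProd ω * x * (cs.wordProd ω)⁻¹ = cs.simple j
      · left
        rw [← hxj]
        group
      · right
        rw [hother j _ hxj, add_zero] at hx
        exact ih x hx
  have hinv : ∀ w x, η w x ≠ 0 → cs.length (w * x) < cs.length w := by
    intro w x hx
    obtain ⟨ω, hω, rfl⟩ := cs.exists_isReduced w
    exact (cs.isRightInversion_of_mem_rightInvSeq hω (hmem ω x hx)).2
  have hrefl : ∀ t, cs.IsReflection t → η t t = 1 := by
    rintro _ ⟨u, j, rfl⟩
    have h1 := hmul (u * cs.simple j) u⁻¹ (u * cs.simple j * u⁻¹)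
    have h2 := hmul u (cs.simple j) (cs.simple j)
    have h3 := hmul u u⁻¹ (u * cs.simple j * u⁻¹)
    have h4 : u⁻¹ * (u * cs.simple j * u⁻¹) * u⁻¹⁻¹ = cs.simple j := by group
    have h5 : cs.simple j * cs.simple j * (cs.simple j)⁻¹ = cs.simple j := by group
    rw [h4] at h1 h3
    rw [h5, hself] at h2
    rw [mul_inv_cancel, hone] at h3
    rw [h1, h2, add_left_comm, ← h3, add_zero]
  have hη : η w t ≠ 0 := by
    intro h0
    have h1 := hmul w t t
    rw [hrefl t ht] at h1
    have h5 : t * t * t⁻¹ = t := by group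
    rw [h5, h0, add_zero] at h1
    have := hinv (w * t) t (by rw [h1]; decide)
    rw [mul_assoc, ht.mul_self, mul_one] at this
    omega
  have h1 := hmul (w * cs.simple i) (cs.simple i) t
  rw [mul_assoc w, cs.simple_mul_simple_self, mul_one, hother i t hne, zero_add] at h1
  rw [h1] at hη
  have h2 := hinv _ _ hη
  simpa [mul_assoc] using h2

variable {cs}

theorem ReflCov.eq_mul_simple {x y : W} {i : B} (h : ReflCov cs x y)
    (hy : cs.IsRightDescent y i) (hx : ¬ cs.IsRightDescent x i) : x = y * cs.simple i := by
  obtain ⟨t, ht, rfl, hlen⟩ := h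
  by_cases hti : t = cs.simple i
  · subst hti; simp
  · exfalso
    have hxx : x * t * t = x := by rw [mul_assoc, ht.mul_self, mul_one]
    have h1 := length_mul_mul_simple_lt cs hra (w := x * t) ht (by rw [hxx]; omega) hti
    rw [hxx] at h1
    rw [cs.isRightDescent_iff] at hy
    rw [cs.not_isRightDescent_iff] at hx
    omega

omit hra in
theorem ReflCov.mul_simple {x y : W} {i : B} (h : ReflCov cs x y)
    (hx : cs.IsRightDescent x i) (hy : cs.IsRightDescent y i) :
    ReflCov cs (x * cs.simple i) (y * cs.simple i) := by
  obtain ⟨t, ht, rfl, hlen⟩ := h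
  rw [cs.isRightDescent_iff] at hx hy
  refine ⟨cs.simple i * t * (cs.simple i)⁻¹, ht.conj _, ?_, ?_⟩
  · simp [mul_assoc]
  · omega

omit hra in
theorem reflCov_mul_simple {y : W} {i : B} (hy : cs.IsRightDescent y i) :
    ReflCov cs (y * cs.simple i) y := by
  rw [cs.isRightDescent_iff] at hy
  exact ⟨cs.simple i, cs.isReflection_simple i, by simp, by omega⟩

theorem isRightDescent_mul_of_isRightDescent {w : W} {i j : B} (hij : i ≠ j)
    (hi : cs.IsRightDescent w i) (hj : cs.IsRightDescent w j) :
    cs.IsRightDescent (w * cs.simple j) i := by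
  by_contra h
  have := (reflCov_mul_simple hj).eq_mul_simple hra hi h
  exact hij (simple_injective_of_rightAngled cs hra (mul_left_cancel this)).symm

theorem isRightDescent_mul_of_commute {w : W} {i j : B} (hij : i ≠ j)
    (hi : cs.IsRightDescent w i) (hM : M i j = 2) :
    cs.IsRightDescent (w * cs.simple j) i := by
  by_cases hj : cs.IsRightDescent w j
  · exact isRightDescent_mul_of_isRightDescent hra hij hi hj
  · rw [cs.not_isRightDescent_iff] at hj
    rw [cs.isRightDescent_iff] at hi
    have h1 := cs.length_mul_le (w * cs.simple i) (cs.simple j)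
    rw [cs.length_simple] at h1
    rw [IsRightDescent, mul_assoc, ← commute_of_eq_two cs hM, ← mul_assoc]
    omega

theorem not_isRightDescent_ladder (n : ℕ) : ∀ (a b : W) (p q : B) (k : ℕ), M p q = 0 →
    cs.length a = n → a⁻¹ * b = (cs.simple q * cs.simple p) ^ k →
    cs.IsRightDescent a p → cs.IsRightDescent b q →
    ReflCov cs (a * cs.simple p) b → ReflCov cs (b * cs.simple q) a → False := by
  induction n with
  | zero =>
    intro a b p q k _ hlen _ hp _ _ _
    rw [IsRightDescent] at hp
    omega
  | succ n ih =>
    intro a b p q k hM hlen hab hp hq hc1 hc2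
    have hM' : M q p = 0 := by rw [M.symmetric]; exact hM
    have hpow : (a * cs.simple p)⁻¹ * (b * cs.simple q)
        = (cs.simple p * cs.simple q) ^ (k + 1) := by
      rw [mul_inv_rev, cs.inv_simple, mul_assoc, ← mul_assoc a⁻¹, hab]
      clear hab
      induction k with
      | zero => simp
      | succ k ihk =>
        rw [pow_succ' _ (k + 1), ← ihk, pow_succ']
        simp only [mul_assoc]
    have hne : a * cs.simple p ≠ b * cs.simple q := by
      intro h
      rw [h, inv_mul_cancel] at hpow
      have := simple_mul_simple_pow_eq_one cs hra hM hpow.symm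
      omega
    have hq' : cs.IsRightDescent (a * cs.simple p) q := by
      by_contra h
      exact hne (hc1.eq_mul_simple hra hq h)
    have hp' : cs.IsRightDescent (b * cs.simple q) p := by
      by_contra h
      exact hne (hc2.eq_mul_simple hra hp h).symm
    refine ih (a * cs.simple p) (b * cs.simple q) q p (k + 1) hM' ?_ hpow hq' hp'
      (hc1.mul_simple hq' hq) (hc2.mul_simple hp' hp)
    rw [cs.isRightDescent_iff] at hp
    omega

theorem eq_two_of_isRightDescent {w : W} {i j : B} (hij : i ≠ j)
    (hi : cs.IsRightDescent w i) (hj : cs.IsRightDescent w j) : M i j = 2 := by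
  rcases hra i j hij with h | h
  · exact h
  · exact (not_isRightDescent_ladder hra _ w w i j 0 h rfl (by simp) hi hj
      (reflCov_mul_simple hi) (reflCov_mul_simple hj)).elim

/-- Below an element without the descent `i` there is at most one covered element having it. -/
theorem eq_of_reflCov_of_not_isRightDescent (n : ℕ) : ∀ (x₁ x₂ y : W) (i : B),
    cs.length y = n → ReflCov cs x₁ y → ReflCov cs x₂ y → ¬ cs.IsRightDescent y i →
    cs.IsRightDescent x₁ i → cs.IsRightDescent x₂ i → x₁ = x₂ := by
  induction n with
  | zero =>
    intro x₁ x₂ y i hlen h1 _ _ _ _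
    obtain ⟨_, _, _, h⟩ := h1
    omega
  | succ n ih =>
    intro x₁ x₂ y i hlen h1 h2 hy hx1 hx2
    have hy1 : y ≠ 1 := by
      rintro rfl
      simp at hlen
    obtain ⟨r, hr⟩ := cs.exists_rightDescent_of_ne_one hy1
    have hri : r ≠ i := by
      rintro rfl
      exact hy hr
    have mixed : ∀ a b : W, cs.IsRightDescent a i → cs.IsRightDescent b i →
        ReflCov cs a y → cs.IsRightDescent b r → cs.IsRightDescent a r := by
      intro a b ha hb hcov hbr
      by_contra har
      have hM := eq_two_of_isRightDescent hra hri.symm hb hbr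
      have hay := hcov.eq_mul_simple hra hr har
      have := isRightDescent_mul_of_commute hra hri.symm ha hM
      rw [hay, cs.simple_mul_simple_cancel_right] at this
      exact hy this
    by_cases hr1 : cs.IsRightDescent x₁ r
    · have hr2 := mixed x₂ x₁ hx2 hx1 h2 hr1
      have hM := eq_two_of_isRightDescent hra hri.symm hx1 hr1
      refine mul_right_cancel (ih (x₁ * cs.simple r) (x₂ * cs.simple r) (y * cs.simple r) i ?_
        (h1.mul_simple hr1 hr) (h2.mul_simple hr2 hr) ?_
        (isRightDescent_mul_of_isRightDescent hra hri.symm hx1 hr1)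
        (isRightDescent_mul_of_isRightDescent hra hri.symm hx2 hr2))
      · rw [cs.isRightDescent_iff] at hr
        omega
      · intro h
        have := isRightDescent_mul_of_commute hra hri.symm h hM
        rw [cs.simple_mul_simple_cancel_right] at this
        exact hy this
    · have hr2 : ¬ cs.IsRightDescent x₂ r := fun h => hr1 (mixed x₁ x₂ hx1 hx2 h1 h)
      rw [h1.eq_mul_simple hra hr hr1, h2.eq_mul_simple hra hr hr2]

/-- The two elements obtained from `y` by removing two distinct descents have `y` as their only
common cover. -/
theorem eq_of_reflCov_mul_simple (n : ℕ) : ∀ (y z : W) (i j : B), cs.length y = n → i ≠ j →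
    cs.IsRightDescent y i → cs.IsRightDescent y j →
    ReflCov cs (y * cs.simple i) z → ReflCov cs (y * cs.simple j) z → y = z := by
  induction n with
  | zero =>
    intro y z i j hlen _ hi _ _ _
    rw [IsRightDescent] at hi
    omega
  | succ n ih =>
    intro y z i j hlen hij hi hj hci hcj
    by_contra hyz
    have hyi : ¬ cs.IsRightDescent (y * cs.simple i) i :=
      cs.isRightDescent_iff_not_isRightDescent_mul.mp hi
    have hyj : ¬ cs.IsRightDescent (y * cs.simple j) j :=
      cs.isRightDescent_iff_not_isRightDescent_mul.mp hj
    have hzi : ¬ cs.IsRightDescent z i := fun h =>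
      hyz (mul_right_cancel (hci.eq_mul_simple hra h hyi))
    have hzj : ¬ cs.IsRightDescent z j := fun h =>
      hyz (mul_right_cancel (hcj.eq_mul_simple hra h hyj))
    have hz1 : z ≠ 1 := by
      rintro rfl
      obtain ⟨_, _, _, h⟩ := hci
      simp at h
    obtain ⟨r, hr⟩ := cs.exists_rightDescent_of_ne_one hz1
    have hri : r ≠ i := by rintro rfl; exact hzi hr
    have hrj : r ≠ j := by rintro rfl; exact hzj hr
    have key : ∀ a b : B, a ≠ b → r ≠ a → r ≠ b → ReflCov cs (y * cs.simple a) z →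
        ReflCov cs (y * cs.simple b) z → cs.IsRightDescent (y * cs.simple a) r := by
      intro a b hab hra' hrb hca hcb
      by_contra h
      have h1 := hca.eq_mul_simple hra hr h
      obtain ⟨_, ⟨w, c, rfl⟩, h2, _⟩ := hcb
      obtain ⟨χa, hχa, hχa'⟩ := exists_parity cs hra a
      obtain ⟨χb, hχb, hχb'⟩ := exists_parity cs hra b
      rw [h2, mul_assoc y, mul_assoc y, mul_left_cancel_iff] at h1
      have hca' : c = a := by
        by_contra hc
        have := congrArg χa h1
        simp only [map_mul, map_inv, hχa, hχa' b hab.symm, hχa' c hc, hχa' r hra', mul_one,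
          mul_inv_cancel] at this
        exact absurd this (by decide)
      have hcb' : c = b := by
        by_contra hc
        have := congrArg χb h1
        simp only [map_mul, map_inv, hχb, hχb' a hab, hχb' c hc, hχb' r hrb, mul_one,
          mul_inv_cancel] at this
        exact absurd this (by decide)
      exact hab (hca'.symm.trans hcb')
    have hir := key i j hij hri hrj hci hcj
    have hjr := key j i hij.symm hrj hri hcj hci
    have hji : cs.IsRightDescent (y * cs.simple i) j :=
      isRightDescent_mul_of_isRightDescent hra hij.symm hj hi
    have hij' : cs.IsRightDescent (y * cs.simple j) i :=
      isRightDescent_mul_of_isRightDescent hra hij hi hj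
    have hMi := eq_two_of_isRightDescent hra hri hjr hij'
    have hMj := eq_two_of_isRightDescent hra hrj hir hji
    have hyr : cs.IsRightDescent y r := by
      have := isRightDescent_mul_of_commute hra hri hir hMi
      rwa [cs.simple_mul_simple_cancel_right] at this
    have comm : ∀ a : B, M r a = 2 →
        y * cs.simple a * cs.simple r = y * cs.simple r * cs.simple a := by
      intro a ha
      rw [mul_assoc, ← commute_of_eq_two cs ha, mul_assoc]
    refine hyz (mul_right_cancel (ih (y * cs.simple r) (z * cs.simple r) i j ?_ hij
      (isRightDescent_mul_of_isRightDescent hra hri.symm hi hyr)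
      (isRightDescent_mul_of_isRightDescent hra hrj.symm hj hyr) ?_ ?_))
    · rw [cs.isRightDescent_iff] at hyr
      omega
    · rw [← comm i hMi]
      exact hci.mul_simple hir hr
    · rw [← comm j hMj]
      exact hcj.mul_simple hjr hr

end RightAngled

/-- The factorization of a butterfly, with a fixed matching between its lower and upper elements. -/
def AltFactorization (cs : CoxeterSystem M W) (x₁ x₂ y₁ y₂ : W) : Prop :=
  ∃ (u v : W) (i i' : B) (m : ℕ), 1 ≤ m ∧ M i i' = 0 ∧
    x₁ = u * cs.wordProd (altList i i' m) * v ∧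
    x₂ = u * cs.wordProd (altList i' i m) * v ∧
    y₁ = u * cs.wordProd (altList i i' (m + 1)) * v ∧
    y₂ = u * cs.wordProd (altList i' i (m + 1)) * v ∧
    cs.length x₁ = cs.length u + cs.length (cs.wordProd (altList i i' m)) + cs.length v ∧
    cs.length x₂ = cs.length u + cs.length (cs.wordProd (altList i' i m)) + cs.length v ∧
    cs.length y₁ = cs.length u + cs.length (cs.wordProd (altList i i' (m + 1))) + cs.length v ∧
    cs.length y₂ = cs.length u + cs.length (cs.wordProd (altList i' i (m + 1))) + cs.length v

theorem AltFactorization.swap {cs : CoxeterSystem M W} {x₁ x₂ y₁ y₂ : W}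
    (h : AltFactorization cs x₁ x₂ y₁ y₂) : AltFactorization cs x₂ x₁ y₂ y₁ := by
  obtain ⟨u, v, i, i', m, hm, hM, h1, h2, h3, h4, h5, h6, h7, h8⟩ := h
  exact ⟨u, v, i', i, m, hm, by rw [M.symmetric]; exact hM, h2, h1, h4, h3, h6, h5, h8, h7⟩

theorem length_eq_add_length_mul_simple {cs : CoxeterSystem M W} {x u a v : W} {r : B}
    (hr : cs.IsRightDescent x r) (hx : x * cs.simple r = u * a * v)
    (hlen : cs.length (x * cs.simple r) = cs.length u + cs.length a + cs.length v) :
    x = u * a * (v * cs.simple r) ∧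
      cs.length x = cs.length u + cs.length a + cs.length (v * cs.simple r) := by
  have hxe : x = u * a * (v * cs.simple r) := by
    rw [← mul_assoc, ← hx, cs.simple_mul_simple_cancel_right]
  refine ⟨hxe, ?_⟩
  rw [cs.isRightDescent_iff] at hr
  have h1 := cs.length_mul_le (u * a) (v * cs.simple r)
  have h2 := cs.length_mul_le u a
  have h3 := cs.length_mul_le v (cs.simple r)
  rw [cs.length_simple] at h3
  rw [← hxe] at h1
  omega

theorem AltFactorization.of_mul_simple {cs : CoxeterSystem M W} {x₁ x₂ y₁ y₂ : W} {r : B}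
    (hx₁ : cs.IsRightDescent x₁ r) (hx₂ : cs.IsRightDescent x₂ r)
    (hy₁ : cs.IsRightDescent y₁ r) (hy₂ : cs.IsRightDescent y₂ r)
    (h : AltFactorization cs (x₁ * cs.simple r) (x₂ * cs.simple r)
      (y₁ * cs.simple r) (y₂ * cs.simple r)) : AltFactorization cs x₁ x₂ y₁ y₂ := by
  obtain ⟨u, v, i, i', m, hm, hM, h1, h2, h3, h4, h5, h6, h7, h8⟩ := h
  obtain ⟨h1, h5⟩ := length_eq_add_length_mul_simple hx₁ h1 h5
  obtain ⟨h2, h6⟩ := length_eq_add_length_mul_simple hx₂ h2 h6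
  obtain ⟨h3, h7⟩ := length_eq_add_length_mul_simple hy₁ h3 h7
  obtain ⟨h4, h8⟩ := length_eq_add_length_mul_simple hy₂ h4 h8
  exact ⟨u, v * cs.simple r, i, i', m, hm, hM, h1, h2, h3, h4, h5, h6, h7, h8⟩

theorem isRightDescent_of_length_add {cs : CoxeterSystem M W} {x u a v : W} {r : B}
    (hx : x = u * a * v) (hlen : cs.length x = cs.length u + cs.length a + cs.length v)
    (hr : cs.IsRightDescent v r) : cs.IsRightDescent x r := by
  rw [IsRightDescent] at *
  have h1 := cs.length_mul_le (u * a) (v * cs.simple r)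
  have h2 := cs.length_mul_le u a
  rw [← mul_assoc, ← hx] at h1
  omega

theorem wordProd_altList_concat (cs : CoxeterSystem M W) (m : ℕ) : ∀ a b : B, ∃ p q : B,
    (p = a ∧ q = b ∨ p = b ∧ q = a) ∧
    cs.wordProd (altList a b (m + 1)) = cs.wordProd (altList a b m) * cs.simple p ∧
    cs.wordProd (altList b a (m + 1)) = cs.wordProd (altList b a m) * cs.simple q ∧
    cs.wordProd (altList a b (m + 1 + 1)) = cs.wordProd (altList a b (m + 1)) * cs.simple q ∧
    cs.wordProd (altList b a (m + 1 + 1)) = cs.wordProd (altList b a (m + 1)) * cs.simple p := by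
  induction m with
  | zero =>
    intro a b
    exact ⟨a, b, Or.inl ⟨rfl, rfl⟩, by simp [altList, wordProd_cons]⟩
  | succ m ih =>
    intro a b
    obtain ⟨p, q, hpq, h1, h2, h3, h4⟩ := ih b a
    have e : ∀ (c d : B) (k : ℕ), cs.wordProd (altList c d (k + 1))
        = cs.simple c * cs.wordProd (altList d c k) := fun c d k => cs.wordProd_cons _ _
    refine ⟨p, q, hpq.symm, ?_, ?_, ?_, ?_⟩
    · rw [e a b (m + 1), h1, ← mul_assoc, ← e]
    · rw [e b a (m + 1), h2, ← mul_assoc, ← e]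
    · rw [e a b (m + 1 + 1), h3, ← mul_assoc, ← e]
    · rw [e b a (m + 1 + 1), h4, ← mul_assoc, ← e]

/-- Extending an alternating factorization with trivial right factor by one more letter. -/
theorem AltFactorization.extend {cs : CoxeterSystem M W}
    (hra : ∀ i j : B, i ≠ j → M i j = 2 ∨ M i j = 0)
    {x₁ x₂ u : W} {i j a b : B} {m : ℕ} (hM : M a b = 0)
    (h₁ : x₁ = u * cs.wordProd (altList a b (m + 1)))
    (h₂ : x₂ = u * cs.wordProd (altList b a (m + 1)))
    (hl₁ : cs.length x₁ = cs.length u + cs.length (cs.wordProd (altList a b (m + 1))))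
    (hl₂ : cs.length x₂ = cs.length u + cs.length (cs.wordProd (altList b a (m + 1))))
    (hj₁ : cs.IsRightDescent x₁ j) (hi₂ : cs.IsRightDescent x₂ i)
    (hi₁ : ¬ cs.IsRightDescent x₁ i) (hj₂ : ¬ cs.IsRightDescent x₂ j)
    (hlen : cs.length x₁ = cs.length x₂)
    (hlow : (x₁ * cs.simple j = u * cs.wordProd (altList a b m) ∧
        x₂ * cs.simple i = u * cs.wordProd (altList b a m)) ∨
      (x₁ * cs.simple j = u * cs.wordProd (altList b a m) ∧
        x₂ * cs.simple i = u * cs.wordProd (altList a b m))) :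
    AltFactorization cs x₁ x₂ (x₁ * cs.simple i) (x₂ * cs.simple j) := by
  have e : ∀ (c d : B) (k : ℕ), cs.wordProd (altList c d (k + 1))
      = cs.simple c * cs.wordProd (altList d c k) := fun c d k => cs.wordProd_cons _ _
  obtain ⟨p, q, hpq, hp, hq, hq', hp'⟩ := wordProd_altList_concat cs m a b
  have hMpq : M p q = 0 := by
    rcases hpq with ⟨rfl, rfl⟩ | ⟨rfl, rfl⟩
    · exact hM
    · rw [M.symmetric]; exact hM
  have hMqp : M q p = 0 := by rw [M.symmetric]; exact hMpq
  have hxp : x₁ * cs.simple p = u * cs.wordProd (altList a b m) := by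
    rw [h₁, hp, ← mul_assoc, cs.simple_mul_simple_cancel_right]
  have hxq : x₂ * cs.simple q = u * cs.wordProd (altList b a m) := by
    rw [h₂, hq, ← mul_assoc, cs.simple_mul_simple_cancel_right]
  have hjl := cs.isRightDescent_iff.mp hj₁
  have hil := cs.isRightDescent_iff.mp hi₂
  have hp₁ : cs.IsRightDescent x₁ p := by
    rw [IsRightDescent, hxp]
    rcases hlow with ⟨h, h'⟩ | ⟨h, h'⟩ <;> rw [h] at hjl <;> rw [h'] at hil <;> omega
  have hq₂ : cs.IsRightDescent x₂ q := by
    rw [IsRightDescent, hxq]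
    rcases hlow with ⟨h, h'⟩ | ⟨h, h'⟩ <;> rw [h] at hjl <;> rw [h'] at hil <;> omega
  have hjp : j = p := by
    by_contra hne
    have h2 := eq_two_of_isRightDescent hra hne hj₁ hp₁
    rcases hlow with ⟨h, _⟩ | ⟨h, _⟩
    · exact hne (simple_injective_of_rightAngled cs hra (mul_left_cancel (h.trans hxp.symm)))
    · have hja : j = a := eq_of_mul_simple_eq cs hra (by rw [h₁, e, ← mul_assoc]) h
      have hjq : j = q := by
        rcases hpq with ⟨hpa, _⟩ | ⟨_, hqa⟩
        · exact absurd (hja.trans hpa.symm) hne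
        · exact hja.trans hqa.symm
      rw [hjq] at h2
      omega
  have hiq : i = q := by
    by_contra hne
    have h2 := eq_two_of_isRightDescent hra hne hi₂ hq₂
    rcases hlow with ⟨_, h⟩ | ⟨_, h⟩
    · exact hne (simple_injective_of_rightAngled cs hra (mul_left_cancel (h.trans hxq.symm)))
    · have hib : i = b := eq_of_mul_simple_eq cs hra (by rw [h₂, e, ← mul_assoc]) h
      have hip : i = p := by
        rcases hpq with ⟨_, hqb⟩ | ⟨hpb, _⟩
        · exact absurd (hib.trans hqb.symm) hne
        · exact hib.trans hpb.symm
      rw [hip] at h2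
      omega
  subst hjp hiq
  rw [cs.not_isRightDescent_iff] at hi₁ hj₂
  have hy₁ : x₁ * cs.simple i = u * cs.wordProd (altList a b (m + 1 + 1)) := by
    rw [hq', ← mul_assoc, ← h₁]
  have hy₂ : x₂ * cs.simple j = u * cs.wordProd (altList b a (m + 1 + 1)) := by
    rw [hp', ← mul_assoc, ← h₂]
  have l1 := cs.length_mul_le u (cs.wordProd (altList a b (m + 1 + 1)))
  have l2 := cs.length_mul_le u (cs.wordProd (altList b a (m + 1 + 1)))
  have l3 := cs.length_mul_le (cs.wordProd (altList a b (m + 1))) (cs.simple i)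
  have l4 := cs.length_mul_le (cs.wordProd (altList b a (m + 1))) (cs.simple j)
  rw [← hq', cs.length_simple] at l3
  rw [← hp', cs.length_simple] at l4
  rw [← hy₁] at l1
  rw [← hy₂] at l2
  refine ⟨u, 1, a, b, m + 1, by omega, hM, ?_, ?_, ?_, ?_, ?_, ?_, ?_, ?_⟩
  · rw [mul_one, ← h₁]
  · rw [mul_one, ← h₂]
  · rw [mul_one, hy₁]
  · rw [mul_one, hy₂]
  all_goals
    rw [cs.length_one]
    omega

section Butterfly

variable {cs : CoxeterSystem M W} (hra : ∀ i j : B, i ≠ j → M i j = 2 ∨ M i j = 0)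

include hra

theorem altFactorization_step {x₁ x₂ : W} {i j : B} (hx : x₁ ≠ x₂)
    (hy : x₁ * cs.simple i ≠ x₂ * cs.simple j)
    (h11 : ReflCov cs x₁ (x₁ * cs.simple i)) (h12 : ReflCov cs x₁ (x₂ * cs.simple j))
    (h21 : ReflCov cs x₂ (x₁ * cs.simple i)) (h22 : ReflCov cs x₂ (x₂ * cs.simple j))
    (hno : ∀ r, cs.IsRightDescent x₁ r → ¬ cs.IsRightDescent x₂ r)
    (ih : ∀ x₁' x₂' : W, x₁' ≠ x₂' → ReflCov cs x₁' x₁ → ReflCov cs x₁' x₂ →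
      ReflCov cs x₂' x₁ → ReflCov cs x₂' x₂ →
      AltFactorization cs x₁' x₂' x₁ x₂ ∨ AltFactorization cs x₁' x₂' x₂ x₁) :
    AltFactorization cs x₁ x₂ (x₁ * cs.simple i) (x₂ * cs.simple j) := by
  have hl1 : cs.length (x₁ * cs.simple i) = cs.length x₁ + 1 := by
    obtain ⟨_, _, _, h⟩ := h11; exact h
  have hl2 : cs.length (x₂ * cs.simple j) = cs.length x₂ + 1 := by
    obtain ⟨_, _, _, h⟩ := h22; exact h
  have hlen : cs.length x₁ = cs.length x₂ := by
    obtain ⟨_, _, _, h⟩ := h21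
    omega
  have hi₁ : ¬ cs.IsRightDescent x₁ i := by rw [cs.not_isRightDescent_iff]; exact hl1
  have hj₂ : ¬ cs.IsRightDescent x₂ j := by rw [cs.not_isRightDescent_iff]; exact hl2
  have hyi : cs.IsRightDescent (x₁ * cs.simple i) i := by
    rw [cs.isRightDescent_iff_not_isRightDescent_mul, cs.simple_mul_simple_cancel_right]
    exact hi₁
  have hyj : cs.IsRightDescent (x₂ * cs.simple j) j := by
    rw [cs.isRightDescent_iff_not_isRightDescent_mul, cs.simple_mul_simple_cancel_right]
    exact hj₂
  have hi₂ : cs.IsRightDescent x₂ i := by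
    by_contra h
    have := h21.eq_mul_simple hra hyi h
    rw [cs.simple_mul_simple_cancel_right] at this
    exact hx this.symm
  have hj₁ : cs.IsRightDescent x₁ j := by
    by_contra h
    have := h12.eq_mul_simple hra hyj h
    rw [cs.simple_mul_simple_cancel_right] at this
    exact hx this
  have hij : i ≠ j := by
    rintro rfl
    exact hi₁ hj₁
  have hMij : M i j = 0 := by
    refine (hra i j hij).resolve_left fun h2 => hy ?_
    rw [h21.eq_mul_simple hra (isRightDescent_mul_of_commute hra hij.symm hj₁
      (by rw [M.symmetric]; exact h2)) hj₂, cs.simple_mul_simple_cancel_right]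
  have hMji : M j i = 0 := by rw [M.symmetric]; exact hMij
  have hc12 : ReflCov cs (x₂ * cs.simple i) x₁ := by
    have := h21.mul_simple hi₂ hyi
    rwa [cs.simple_mul_simple_cancel_right] at this
  have hc21 : ReflCov cs (x₁ * cs.simple j) x₂ := by
    have := h12.mul_simple hj₁ hyj
    rwa [cs.simple_mul_simple_cancel_right] at this
  by_cases heq : x₂ * cs.simple i = x₁ * cs.simple j
  · have e1 : ∀ a b : B, cs.wordProd (altList a b 0) = 1 := fun a b => cs.wordProd_nil
    have e2 : ∀ a b : B, cs.wordProd (altList a b 1) = cs.simple a := fun a b => by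
      simp [altList]
    have hd₁ := cs.isRightDescent_iff.mp hj₁
    have hd₂ := cs.isRightDescent_iff.mp hi₂
    refine AltFactorization.extend hra (u := x₂ * cs.simple i) (a := j) (b := i) (m := 0) hMji
      ?_ ?_ ?_ ?_ hj₁ hi₂ hi₁ hj₂ hlen (Or.inl ⟨?_, ?_⟩)
    · rw [e2, heq, cs.simple_mul_simple_cancel_right]
    · rw [e2, cs.simple_mul_simple_cancel_right]
    · rw [e2, cs.length_simple, heq, hd₁]
    · rw [e2, cs.length_simple, hd₂]
    · rw [e1, mul_one, heq]
    · rw [e1, mul_one]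
  · have hv : ∀ (u a b v : W), x₁ = u * a * v → x₂ = u * b * v →
        cs.length x₁ = cs.length u + cs.length a + cs.length v →
        cs.length x₂ = cs.length u + cs.length b + cs.length v → v = 1 := by
      intro u a b v e1 e2 l1 l2
      by_contra hv1
      obtain ⟨r, hr⟩ := cs.exists_rightDescent_of_ne_one hv1
      exact hno r (isRightDescent_of_length_add e1 l1 hr) (isRightDescent_of_length_add e2 l2 hr)
    rcases ih _ _ heq hc12 (reflCov_mul_simple hi₂) (reflCov_mul_simple hj₁) hc21 with
      ⟨u, v, a, b, m, hm, hM, e1, e2, e3, e4, l1, l2, l3, l4⟩ |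
      ⟨u, v, a, b, m, hm, hM, e1, e2, e4, e3, l1, l2, l4, l3⟩
    · obtain rfl := hv _ _ _ _ e3 e4 l3 l4
      simp only [mul_one, cs.length_one, add_zero] at e1 e2 e3 e4 l3 l4
      exact AltFactorization.extend hra hM e3 e4 l3 l4 hj₁ hi₂ hi₁ hj₂ hlen (Or.inr ⟨e2, e1⟩)
    · obtain rfl := hv _ _ _ _ e3 e4 l3 l4
      simp only [mul_one, cs.length_one, add_zero] at e1 e2 e3 e4 l3 l4
      exact AltFactorization.extend hra (by rw [M.symmetric]; exact hM) e3 e4 l3 l4 hj₁ hi₂ hi₁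
        hj₂ hlen (Or.inl ⟨e2, e1⟩)

theorem altFactorization_of_butterfly (n : ℕ) : ∀ x₁ x₂ y₁ y₂ : W, cs.length y₁ = n →
    x₁ ≠ x₂ → y₁ ≠ y₂ → ReflCov cs x₁ y₁ → ReflCov cs x₁ y₂ → ReflCov cs x₂ y₁ →
    ReflCov cs x₂ y₂ → AltFactorization cs x₁ x₂ y₁ y₂ ∨ AltFactorization cs x₁ x₂ y₂ y₁ := by
  induction n with
  | zero =>
    intro x₁ x₂ y₁ y₂ hlen _ _ h11 _ _ _
    obtain ⟨_, _, _, h⟩ := h11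
    omega
  | succ n ih =>
    intro x₁ x₂ y₁ y₂ hlen hx hy h11 h12 h21 h22
    by_cases hcommon : ∃ r, cs.IsRightDescent x₁ r ∧ cs.IsRightDescent x₂ r
    · obtain ⟨r, hx₁, hx₂⟩ := hcommon
      have hy₁ : cs.IsRightDescent y₁ r := by
        by_contra h
        exact hx (eq_of_reflCov_of_not_isRightDescent hra _ x₁ x₂ y₁ r rfl h11 h21 h hx₁ hx₂)
      have hy₂ : cs.IsRightDescent y₂ r := by
        by_contra h
        exact hx (eq_of_reflCov_of_not_isRightDescent hra _ x₁ x₂ y₂ r rfl h12 h22 h hx₁ hx₂)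
      have hlen' : cs.length (y₁ * cs.simple r) = n := by
        have := cs.isRightDescent_iff.mp hy₁
        omega
      exact (ih _ _ _ _ hlen' (mul_left_injective _ |>.ne hx) (mul_left_injective _ |>.ne hy)
        (h11.mul_simple hx₁ hy₁) (h12.mul_simple hx₁ hy₂) (h21.mul_simple hx₂ hy₁)
        (h22.mul_simple hx₂ hy₂)).imp (.of_mul_simple hx₁ hx₂ hy₁ hy₂)
          (.of_mul_simple hx₁ hx₂ hy₂ hy₁)
    · have hno : ∀ r, cs.IsRightDescent x₁ r → ¬ cs.IsRightDescent x₂ r :=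
        fun r h1 h2 => hcommon ⟨r, h1, h2⟩
      have hcases : ∀ y, ReflCov cs x₁ y → ReflCov cs x₂ y →
          ∃ i, y = x₁ * cs.simple i ∨ y = x₂ * cs.simple i := by
        intro y h1 h2
        have hy1 : y ≠ 1 := by
          rintro rfl
          obtain ⟨_, _, _, h⟩ := h1
          simp at h
        obtain ⟨i, hi⟩ := cs.exists_rightDescent_of_ne_one hy1
        refine ⟨i, ?_⟩
        by_cases hx₁ : cs.IsRightDescent x₁ i
        · right
          rw [h2.eq_mul_simple hra hi (hno i hx₁), cs.simple_mul_simple_cancel_right]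
        · left
          rw [h1.eq_mul_simple hra hi hx₁, cs.simple_mul_simple_cancel_right]
      have same : ∀ (a b : W) (i j : B), a ≠ b → ReflCov cs a (a * cs.simple i) →
          ReflCov cs a (a * cs.simple j) → ReflCov cs b (a * cs.simple i) →
          ReflCov cs b (a * cs.simple j) → i = j := by
        intro a b i j hab hai haj hbi hbj
        by_contra hij
        have descent : ∀ k, ReflCov cs a (a * cs.simple k) → ReflCov cs b (a * cs.simple k) →
            cs.IsRightDescent b k ∧ ReflCov cs (b * cs.simple k) a := by
          intro k hak hbk
          obtain ⟨_, _, _, hl⟩ := hak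
          have hk : cs.IsRightDescent (a * cs.simple k) k := by
            rw [IsRightDescent, cs.simple_mul_simple_cancel_right]
            omega
          have hbk' : cs.IsRightDescent b k := by
            by_contra h
            have := hbk.eq_mul_simple hra hk h
            rw [cs.simple_mul_simple_cancel_right] at this
            exact hab this.symm
          refine ⟨hbk', ?_⟩
          have := hbk.mul_simple hbk' hk
          rwa [cs.simple_mul_simple_cancel_right] at this
        obtain ⟨hi, hci⟩ := descent i hai hbi
        obtain ⟨hj, hcj⟩ := descent j haj hbj
        exact hab (eq_of_reflCov_mul_simple hra _ b a i j rfl hij hi hj hci hcj).symm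
      have hl : cs.length x₁ = n := by
        obtain ⟨_, _, _, h⟩ := h11
        omega
      obtain ⟨i, hi⟩ := hcases y₁ h11 h21
      obtain ⟨j, hj⟩ := hcases y₂ h12 h22
      rcases hi with rfl | rfl <;> rcases hj with rfl | rfl
      · exact absurd (congrArg (x₁ * cs.simple ·) (same x₁ x₂ i j hx h11 h12 h21 h22)) hy
      · left
        exact altFactorization_step hra hx hy h11 h12 h21 h22 hno
          fun a b hab a1 a2 b1 b2 => ih a b _ _ hl hab hx a1 a2 b1 b2
      · right
        exact altFactorization_step hra hx hy.symm h12 h11 h22 h21 hno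
          fun a b hab a1 a2 b1 b2 => ih a b _ _ hl hab hx a1 a2 b1 b2
      · exact absurd (congrArg (x₂ * cs.simple ·) (same x₂ x₁ i j hx.symm h21 h22 h11 h12)) hy

end Butterfly

/-- In a right-angled Coxeter group, every butterfly `x₁, x₂ ⋖ y₁, y₂` has length-additive
factorizations `x₁ = u·A^(m)(s,s')·v`, `x₂ = u·A^(m)(s',s)·v`,
`{y₁, y₂} = {u·A^(m+1)(s,s')·v, u·A^(m+1)(s',s)·v}` for some `m ≥ 1`, `u, v ∈ W`, and
non-commuting simple reflections `s = s_i`, `s' = s_{i'}`. -/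
theorem stmt10 (cs : CoxeterSystem M W)
    (hra : ∀ i j : B, i ≠ j → M i j = 2 ∨ M i j = 0)
    (x₁ x₂ y₁ y₂ : W) (hx : x₁ ≠ x₂) (hy : y₁ ≠ y₂)
    (h11 : bruhatCovBy cs x₁ y₁) (h12 : bruhatCovBy cs x₁ y₂)
    (h21 : bruhatCovBy cs x₂ y₁) (h22 : bruhatCovBy cs x₂ y₂) :
    ∃ (u v : W) (i i' : B) (m : ℕ), 1 ≤ m ∧ M i i' = 0 ∧
      x₁ = u * cs.wordProd (altList i i' m) * v ∧
      x₂ = u * cs.wordProd (altList i' i m) * v ∧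
      cs.length x₁ = cs.length u + cs.length (cs.wordProd (altList i i' m)) + cs.length v ∧
      cs.length x₂ = cs.length u + cs.length (cs.wordProd (altList i' i m)) + cs.length v ∧
      ((y₁ = u * cs.wordProd (altList i i' (m + 1)) * v ∧
          y₂ = u * cs.wordProd (altList i' i (m + 1)) * v) ∨
        (y₂ = u * cs.wordProd (altList i i' (m + 1)) * v ∧
          y₁ = u * cs.wordProd (altList i' i (m + 1)) * v)) ∧
      cs.length y₁ = cs.length u + cs.length (u⁻¹ * y₁ * v⁻¹) + cs.length v ∧
      cs.length y₂ = cs.length u + cs.length (u⁻¹ * y₂ * v⁻¹) + cs.length v := by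
  have key : ∀ a b m (u v y : W), y = u * cs.wordProd (altList a b m) * v →
      u⁻¹ * y * v⁻¹ = cs.wordProd (altList a b m) := by
    rintro a b m u v _ rfl
    group
  rcases altFactorization_of_butterfly hra _ x₁ x₂ y₁ y₂ rfl hx hy h11.reflCov h12.reflCov
    h21.reflCov h22.reflCov with
    ⟨u, v, i, i', m, hm, hM, e1, e2, e3, e4, l1, l2, l3, l4⟩ |
    ⟨u, v, i, i', m, hm, hM, e1, e2, e4, e3, l1, l2, l4, l3⟩
  · refine ⟨u, v, i, i', m, hm, hM, e1, e2, l1, l2, Or.inl ⟨e3, e4⟩, ?_, ?_⟩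
    · rw [key _ _ _ _ _ _ e3, l3]
    · rw [key _ _ _ _ _ _ e4, l4]
  · refine ⟨u, v, i, i', m, hm, hM, e1, e2, l1, l2, Or.inr ⟨e4, e3⟩, ?_, ?_⟩
    · rw [key _ _ _ _ _ _ e3, l3]
    · rw [key _ _ _ _ _ _ e4, l4]
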